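/- Let u : ℝ × ℝ → ℝ be differentiable with sup_{(t,x)} (|∂ₓu(t,x)| + |∂ₜu(t,x)|) ≤ ε for ε sufficiently small, and let λ(t) = C t/(log t)². If (tₙ) is a sequence of times with tₙ ≥ 2 and lim_{n→∞} ∫_ℝ sech²(x/λ(tₙ)) ( (∂ₜu)² + (∂ₓu)² )(tₙ, x) dx = 0, then also lim_{n→∞} ∫_ℝ sech⁴(x/λ(tₙ)) ( (1 + (∂ₓu)²)/(1 + (∂ₓu)² - (∂ₜu)²)^{1/2} - 1 )(tₙ, x) dx = 0. -/

import Mathlib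

open MeasureTheory Real Filter

/-- Time derivative `∂ₜ u` of a scalar field `u : ℝ × ℝ → ℝ` (first variable is time). -/
noncomputable def ut (u : ℝ × ℝ → ℝ) (t x : ℝ) : ℝ := deriv (fun s => u (s, x)) t

/-- Space derivative `∂ₓ u`. -/
noncomputable def ux (u : ℝ × ℝ → ℝ) (t x : ℝ) : ℝ := deriv (fun y => u (t, y)) x

/-- `∂ₜ² u`. -/
noncomputable def utt (u : ℝ × ℝ → ℝ) (t x : ℝ) : ℝ := deriv (fun s => ut u s x) t

/-- `∂ₓ² u`. -/
noncomputable def uxx (u : ℝ × ℝ → ℝ) (t x : ℝ) : ℝ := deriv (fun y => ux u t y) x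

/-- Mixed derivative `∂²ₜₓ u`. -/
noncomputable def utx (u : ℝ × ℝ → ℝ) (t x : ℝ) : ℝ := deriv (fun s => ux u s x) t

/-- The Born–Infeld equation in 1+1 dimensions:
`(1 - (∂ₜu)²) ∂ₓ²u + 2 ∂ₓu ∂ₜu ∂²ₜₓu - (1 + (∂ₓu)²) ∂ₜ²u = 0`. -/
def IsBISol (u : ℝ × ℝ → ℝ) : Prop :=
  ∀ t x : ℝ,
    (1 - (ut u t x) ^ 2) * uxx u t x
      + 2 * ux u t x * ut u t x * utx u t x
      - (1 + (ux u t x) ^ 2) * utt u t x = 0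

/-- The scaling function `λ(t) = C t / (log t)²`. -/
noncomputable def lam (C t : ℝ) : ℝ := C * t / (Real.log t) ^ 2

/-- Hyperbolic secant. -/
noncomputable def sech (x : ℝ) : ℝ := 1 / Real.cosh x

/-- The localized energy density is nonnegative and controlled by the square gradient. -/
lemma energy_density_bounds {a b : ℝ} (hb : b ^ 2 ≤ 1 / 2) :
    0 ≤ (1 + a ^ 2) / √(1 + a ^ 2 - b ^ 2) - 1 ∧
      (1 + a ^ 2) / √(1 + a ^ 2 - b ^ 2) - 1 ≤ 2 * (b ^ 2 + a ^ 2) := by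
  have ha0 := sq_nonneg a
  have hb0 := sq_nonneg b
  have hlow : 1 - b ^ 2 ≤ √(1 + a ^ 2 - b ^ 2) := by
    apply Real.le_sqrt_of_sq_le
    nlinarith
  have hup : √(1 + a ^ 2 - b ^ 2) ≤ 1 + a ^ 2 := by
    rw [Real.sqrt_le_left (by positivity)]
    nlinarith
  have hpos : 0 < √(1 + a ^ 2 - b ^ 2) := by linarith
  constructor
  · rw [sub_nonneg, le_div_iff₀ hpos]
    linarith
  · rw [sub_le_iff_le_add, div_le_iff₀ hpos]
    calc 1 + a ^ 2 ≤ (2 * (b ^ 2 + a ^ 2) + 1) * (1 - b ^ 2) := by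
          nlinarith [mul_nonneg ha0 (sub_nonneg.2 hb), mul_nonneg hb0 (sub_nonneg.2 hb)]
      _ ≤ _ := by gcongr

lemma sech_sq_nonneg (x : ℝ) : 0 ≤ sech x ^ 2 := sq_nonneg _

lemma sech_sq_le_inv_one_add_sq (x : ℝ) : sech x ^ 2 ≤ (1 + x ^ 2)⁻¹ := by
  have h : x ^ 2 ≤ Real.sinh x ^ 2 := by
    rcases le_total 0 x with hx | hx
    · exact pow_le_pow_left₀ hx (Real.self_le_sinh_iff.2 hx) 2
    · have := Real.sinh_le_self_iff.2 hx
      nlinarith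
  rw [sech, div_pow, one_pow, one_div]
  apply inv_anti₀ (by positivity)
  rw [Real.cosh_sq]
  linarith

lemma sech_sq_le_one (x : ℝ) : sech x ^ 2 ≤ 1 :=
  (sech_sq_le_inv_one_add_sq x).trans (inv_le_one_of_one_le₀ (by nlinarith [sq_nonneg x]))

lemma continuous_sech : Continuous sech :=
  continuous_const.div Real.continuous_cosh fun x => (Real.cosh_pos x).ne'

lemma integrable_sech_sq : Integrable fun x : ℝ => sech x ^ 2 :=
  integrable_inv_one_add_sq.mono' (continuous_sech.pow 2).aestronglyMeasurable <|
    Eventually.of_forall fun x => by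
      rw [Real.norm_of_nonneg (sech_sq_nonneg x)]
      exact sech_sq_le_inv_one_add_sq x

lemma lam_pos {C t : ℝ} (hC : 0 < C) (ht : 2 ≤ t) : 0 < lam C t := by
  have : 0 < Real.log t := Real.log_pos (by linarith)
  unfold lam
  positivity

lemma measurable_ut {u : ℝ × ℝ → ℝ} (hu : Continuous u) (t : ℝ) : Measurable (ut u t) := by
  have h : Continuous (Function.uncurry fun x s : ℝ => u (s, x)) := hu.comp continuous_swap
  exact (measurable_deriv_with_param h).comp measurable_prodMk_right

lemma measurable_ux (u : ℝ × ℝ → ℝ) (t : ℝ) : Measurable (ux u t) :=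
  measurable_deriv _

/-- Lemma 2.4: if along a sequence of times `tₙ ≥ 2` the localized square gradient
`∫ sech²(x/λ(tₙ)) ((∂ₜu)² + (∂ₓu)²) dx` tends to `0`, then so does the localized energy
`∫ sech⁴(x/λ(tₙ)) ((1+(∂ₓu)²)/√(1+(∂ₓu)²-(∂ₜu)²) - 1) dx`. -/
theorem energy_sequential_decay :
    ∃ ε₀ : ℝ, 0 < ε₀ ∧ ∀ C : ℝ, 0 < C → ∀ ε : ℝ, 0 < ε → ε ≤ ε₀ →
    ∀ u : ℝ × ℝ → ℝ, Differentiable ℝ u →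
    (∀ t x : ℝ, |ux u t x| + |ut u t x| ≤ ε) →
    ∀ tseq : ℕ → ℝ, (∀ n, 2 ≤ tseq n) →
    Tendsto (fun n => ∫ x : ℝ, (sech (x / lam C (tseq n))) ^ 2
        * ((ut u (tseq n) x) ^ 2 + (ux u (tseq n) x) ^ 2)) atTop (nhds 0) →
    Tendsto (fun n => ∫ x : ℝ, (sech (x / lam C (tseq n))) ^ 4
        * ((1 + (ux u (tseq n) x) ^ 2)
            / Real.sqrt (1 + (ux u (tseq n) x) ^ 2 - (ut u (tseq n) x) ^ 2) - 1))
      atTop (nhds 0) := by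
  refine ⟨1 / 2, by norm_num, fun C hC ε _ hε u hu hbound tseq ht hlim => ?_⟩
  have hut : ∀ t x, ut u t x ^ 2 ≤ 1 / 4 := fun t x => by
    have h1 := hbound t x
    have h2 := abs_nonneg (ux u t x)
    rw [← sq_abs]
    nlinarith [abs_nonneg (ut u t x)]
  have hux : ∀ t x, ux u t x ^ 2 ≤ 1 / 4 := fun t x => by
    have h1 := hbound t x
    have h2 := abs_nonneg (ut u t x)
    rw [← sq_abs]
    nlinarith [abs_nonneg (ux u t x)]
  have hint : ∀ n, Integrable fun x : ℝ => sech (x / lam C (tseq n)) ^ 2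
      * (ut u (tseq n) x ^ 2 + ux u (tseq n) x ^ 2) := fun n => by
    refine (integrable_sech_sq.comp_div (lam_pos hC (ht n)).ne').mul_bdd (c := 1)
      (((measurable_ut hu.continuous _).pow_const 2).add
        ((measurable_ux u _).pow_const 2)).aestronglyMeasurable
      (Eventually.of_forall fun x => ?_)
    rw [Real.norm_of_nonneg (by positivity)]
    linarith [hut (tseq n) x, hux (tseq n) x]
  have hdens := fun n x =>
    energy_density_bounds (a := ux u (tseq n) x) ((hut (tseq n) x).trans (by norm_num))
  refine squeeze_zero (fun n => integral_nonneg fun x => ?_) (fun n => ?_)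
    (by simpa using hlim.const_mul 2)
  · exact mul_nonneg (by positivity) (hdens n x).1
  · rw [← integral_const_mul]
    refine integral_mono_of_nonneg
      (Eventually.of_forall fun x => mul_nonneg (by positivity) (hdens n x).1)
      ((hint n).const_mul 2) (Eventually.of_forall fun x => ?_)
    have h4 : sech (x / lam C (tseq n)) ^ 4 ≤ sech (x / lam C (tseq n)) ^ 2 := by
      nlinarith [sech_sq_le_one (x / lam C (tseq n)), sech_sq_nonneg (x / lam C (tseq n))]
    calc _ ≤ sech (x / lam C (tseq n)) ^ 2
          * (2 * (ut u (tseq n) x ^ 2 + ux u (tseq n) x ^ 2)) :=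
          mul_le_mul h4 (hdens n x).2 (hdens n x).1 (sech_sq_nonneg _)
      _ = _ := by ring
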